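/- (Weyl integration formula for USp(4)) Let J be the 4×4 block-diagonal matrix with two diagonal blocks [[0,1],[−1,0]], and let G = USp(4) = {A ∈ GL_4(ℂ) : A unitary and AᵀJA = J} be the compact symplectic group of degree 4, with Haar probability measure μ. Then for every continuous function f : G → ℂ that is invariant under conjugation by elements of G, ∫_G f dμ = (8/π²) ∫_0^π ∫_0^π f(diag(e^{iθ₁}, e^{−iθ₁}, e^{iθ₂}, e^{−iθ₂})) · (cos θ₁ − cos θ₂)² · sin² θ₁ · sin² θ₂ dθ₁ dθ₂. -/

import Mathlib

open MeasureTheory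

/-- The standard symplectic form matrix: block-diagonal with two blocks `[[0,1],[-1,0]]`. -/
def Jmat : Matrix (Fin 4) (Fin 4) ℂ :=
  !![0, 1, 0, 0; -1, 0, 0, 0; 0, 0, 0, 1; 0, 0, -1, 0]

/-- `USp(4)`: the compact symplectic group of degree 4, i.e. the set of unitary `4 × 4`
complex matrices `A` with `Aᵀ * J * A = J`. -/
def USp4 : Set (Matrix (Fin 4) (Fin 4) ℂ) :=
  {A | A ∈ Matrix.unitaryGroup (Fin 4) ℂ ∧ A.transpose * Jmat * A = Jmat}

/-- The diagonal matrix `diag(e^{iθ₁}, e^{-iθ₁}, e^{iθ₂}, e^{-iθ₂})`. -/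
noncomputable def uspDiag (θ₁ θ₂ : ℝ) : Matrix (Fin 4) (Fin 4) ℂ :=
  Matrix.diagonal
    ![Complex.exp (θ₁ * Complex.I), Complex.exp (-θ₁ * Complex.I),
      Complex.exp (θ₂ * Complex.I), Complex.exp (-θ₂ * Complex.I)]

/-! ### The group `USp(4)` -/

theorem Jmat_mul_Jmat : Jmat * Jmat = -1 := by
  ext i j
  fin_cases i <;> fin_cases j <;> simp [Jmat, Matrix.mul_apply, Fin.sum_univ_four]

theorem star_mul_self_of_mem_USp4 {A : Matrix (Fin 4) (Fin 4) ℂ} (hA : A ∈ USp4) :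
    star A * A = 1 := Matrix.mem_unitaryGroup_iff'.1 hA.1

theorem mul_star_self_of_mem_USp4 {A : Matrix (Fin 4) (Fin 4) ℂ} (hA : A ∈ USp4) :
    A * star A = 1 := Matrix.mem_unitaryGroup_iff.1 hA.1

theorem inv_eq_star_of_mem_USp4 {A : Matrix (Fin 4) (Fin 4) ℂ} (hA : A ∈ USp4) :
    A⁻¹ = star A := Matrix.inv_eq_left_inv (star_mul_self_of_mem_USp4 hA)

theorem star_eq_symplectic_adjoint {A : Matrix (Fin 4) (Fin 4) ℂ} (hA : A ∈ USp4) :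
    star A = -(Jmat * A.transpose * Jmat) := by
  have h : -(Jmat * A.transpose * Jmat) * A = 1 := by
    rw [neg_mul, Matrix.mul_assoc, Matrix.mul_assoc, ← Matrix.mul_assoc A.transpose, hA.2,
      Jmat_mul_Jmat, neg_neg]
  calc star A = (-(Jmat * A.transpose * Jmat) * A) * star A := by rw [h, one_mul]
    _ = _ := by rw [Matrix.mul_assoc, mul_star_self_of_mem_USp4 hA, mul_one]

theorem mul_mem_USp4 {A B : Matrix (Fin 4) (Fin 4) ℂ} (hA : A ∈ USp4) (hB : B ∈ USp4) :
    A * B ∈ USp4 := by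
  refine ⟨mul_mem hA.1 hB.1, ?_⟩
  calc (A * B).transpose * Jmat * (A * B)
      = B.transpose * (A.transpose * Jmat * A) * B := by
        simp only [Matrix.transpose_mul, Matrix.mul_assoc]
    _ = Jmat := by rw [hA.2, hB.2]

theorem isCompact_USp4 : IsCompact USp4 := by
  have hb : IsCompact (Set.univ.pi fun _ : Fin 4 => Set.univ.pi fun _ : Fin 4 =>
      Metric.closedBall (0 : ℂ) 1) :=
    isCompact_univ_pi fun _ => isCompact_univ_pi fun _ => isCompact_closedBall _ _
  refine IsCompact.of_isClosed_subset hb ?_ ?_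
  · have : USp4 = {A | star A * A = 1} ∩ {A | A.transpose * Jmat * A = Jmat} := by
      ext A
      simp [USp4, Matrix.mem_unitaryGroup_iff']
    rw [this]
    refine IsClosed.inter (isClosed_eq ?_ continuous_const) (isClosed_eq ?_ continuous_const)
    · exact (continuous_id.matrix_conjTranspose).matrix_mul continuous_id
    · exact ((continuous_id.matrix_transpose).matrix_mul continuous_const).matrix_mul continuous_id
  · intro A hA i _ j _
    rw [mem_closedBall_zero_iff]
    exact entry_norm_bound_of_unitary hA.1 i j

theorem uspDiag_eq (a b : ℝ) : uspDiag a b =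
    !![Complex.exp (a * Complex.I), 0, 0, 0; 0, Complex.exp (-a * Complex.I), 0, 0;
      0, 0, Complex.exp (b * Complex.I), 0; 0, 0, 0, Complex.exp (-b * Complex.I)] := by
  ext i j
  fin_cases i <;> fin_cases j <;> simp [uspDiag]

theorem uspDiag_mem_USp4 (a b : ℝ) : uspDiag a b ∈ USp4 := by
  have h : ∀ x : ℝ, Complex.exp (x * Complex.I) * Complex.exp (-x * Complex.I) = 1 := fun x => by
    rw [← Complex.exp_add]; simp
  have hc : ∀ x : ℝ, (starRingEnd ℂ) (Complex.exp (x * Complex.I)) =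
      Complex.exp (-x * Complex.I) := fun x => by
    rw [← Complex.exp_conj]; simp
  have hc' : ∀ x : ℝ, (starRingEnd ℂ) (Complex.exp (-x * Complex.I)) =
      Complex.exp (x * Complex.I) := fun x => by
    rw [← Complex.exp_conj]; simp
  have h' : ∀ x : ℝ, Complex.exp (-x * Complex.I) * Complex.exp (x * Complex.I) = 1 := fun x => by
    rw [mul_comm, h]
  constructor
  · rw [Matrix.mem_unitaryGroup_iff']
    ext i j
    fin_cases i <;> fin_cases j <;>
      simp [uspDiag, Matrix.star_eq_conjTranspose, -neg_mul, hc, hc', h, h',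
        Matrix.diagonal_conjTranspose]
  · ext i j
    fin_cases i <;> fin_cases j <;>
      simp [uspDiag_eq, Jmat, Matrix.mul_apply, Fin.sum_univ_four, -neg_mul, h]
    all_goals rw [neg_mul, h']

/-- The matrix exchanging the two symplectic planes. -/
def planeSwap : Matrix (Fin 4) (Fin 4) ℂ :=
  !![0, 0, 1, 0; 0, 0, 0, 1; 1, 0, 0, 0; 0, 1, 0, 0]

theorem planeSwap_mem_USp4 : planeSwap ∈ USp4 := by
  constructor
  · rw [Matrix.mem_unitaryGroup_iff']
    ext i j
    fin_cases i <;> fin_cases j <;>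
      simp [planeSwap, Matrix.star_eq_conjTranspose, Matrix.mul_apply, Fin.sum_univ_four]
  · ext i j
    fin_cases i <;> fin_cases j <;>
      simp [planeSwap, Jmat, Matrix.mul_apply, Fin.sum_univ_four]

theorem planeSwap_conj_uspDiag (a b : ℝ) :
    planeSwap * uspDiag a b * planeSwap⁻¹ = uspDiag b a := by
  rw [inv_eq_star_of_mem_USp4 planeSwap_mem_USp4]
  ext i j
  fin_cases i <;> fin_cases j <;>
    simp [planeSwap, uspDiag_eq, Matrix.star_eq_conjTranspose, Matrix.mul_apply,
      Fin.sum_univ_four]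

/-- The quaternionic structure map `v ↦ -J v̄` on `ℂ⁴`. -/
noncomputable def quatConj (v : Fin 4 → ℂ) : Fin 4 → ℂ := -(Jmat.mulVec (star v))

theorem quatConj_eq (v : Fin 4 → ℂ) :
    quatConj v = ![-star (v 1), star (v 0), -star (v 3), star (v 2)] := by
  ext i
  fin_cases i <;> simp [quatConj, Jmat, dotProduct, Fin.sum_univ_four]

theorem mulVec_quatConj {A : Matrix (Fin 4) (Fin 4) ℂ} (hA : A ∈ USp4) (v : Fin 4 → ℂ) :
    A.mulVec (quatConj v) = quatConj (A.mulVec v) := by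
  have h1 : A.transpose * A.map star = 1 := by
    have := congrArg Matrix.transpose (star_mul_self_of_mem_USp4 hA)
    rw [Matrix.transpose_mul, Matrix.transpose_one] at this
    exact this
  have h : A * Jmat = Jmat * A.map star := by
    have h2 : A * Jmat * A.transpose = Jmat := by
      have h3 := star_eq_symplectic_adjoint hA
      have h4 := mul_star_self_of_mem_USp4 hA
      rw [h3] at h4
      have h5 : (A * Jmat * A.transpose) * Jmat = -1 := by
        rw [← h4]; simp [Matrix.mul_assoc]
      have h6 := congrArg (· * Jmat) h5
      simp only [Matrix.mul_assoc, Jmat_mul_Jmat] at h6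
      simpa [Matrix.mul_assoc] using h6
    calc A * Jmat = A * Jmat * (A.transpose * A.map star) := by rw [h1, mul_one]
      _ = _ := by rw [← Matrix.mul_assoc, h2]
  have h7 : star (A.mulVec v) = (A.map star).mulVec (star v) := by
    ext i; simp [Matrix.mulVec, dotProduct]
  rw [quatConj, quatConj, h7, Matrix.mulVec_neg, Matrix.mulVec_mulVec, h, Matrix.mulVec_mulVec]

theorem quatConj_smul (c : ℂ) (v : Fin 4 → ℂ) : quatConj (c • v) = star c • quatConj v := by
  rw [quatConj_eq, quatConj_eq]
  ext i
  fin_cases i <;> simp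

theorem star_quatConj_dotProduct_self (v : Fin 4 → ℂ) :
    star (quatConj v) ⬝ᵥ quatConj v = star v ⬝ᵥ v := by
  rw [quatConj_eq]
  simp [dotProduct, Fin.sum_univ_four]
  ring

theorem star_mulVec_dotProduct_mulVec {A : Matrix (Fin 4) (Fin 4) ℂ} (hA : A ∈ USp4)
    (u v : Fin 4 → ℂ) : star (A.mulVec u) ⬝ᵥ A.mulVec v = star u ⬝ᵥ v := by
  rw [Matrix.star_mulVec, ← Matrix.dotProduct_mulVec, Matrix.mulVec_mulVec,
    ← Matrix.star_eq_conjTranspose, star_mul_self_of_mem_USp4 hA, Matrix.one_mulVec]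

theorem eq_exp_arccos_of_norm_eq_one {κ : ℂ} (h : ‖κ‖ = 1) (h0 : 0 ≤ κ.im) :
    κ = Complex.exp (Real.arccos κ.re * Complex.I) := by
  have h2 : κ.re ^ 2 + κ.im ^ 2 = 1 := by
    have := Complex.sq_norm κ
    rw [h, Complex.normSq_apply] at this
    linarith
  rw [Complex.exp_mul_I, ← Complex.ofReal_cos, ← Complex.ofReal_sin,
    Real.cos_arccos (by nlinarith) (by nlinarith), Real.sin_arccos,
    show 1 - κ.re ^ 2 = κ.im ^ 2 by linarith, Real.sqrt_sq h0, Complex.re_add_im]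

theorem exists_unit_eigenvector {A : Matrix (Fin 4) (Fin 4) ℂ} (hA : A ∈ USp4)
    {W : Submodule ℂ (Fin 4 → ℂ)} (hW : W ≠ ⊥) (hAW : ∀ v ∈ W, A.mulVec v ∈ W) :
    ∃ v ∈ W, ∃ κ : ℂ, ‖κ‖ = 1 ∧ star v ⬝ᵥ v = 1 ∧ A.mulVec v = κ • v := by
  have : Nontrivial W := Submodule.nontrivial_iff_ne_bot.2 hW
  obtain ⟨κ, hκ⟩ := Module.End.exists_eigenvalue (A.mulVecLin.restrict hAW)
  obtain ⟨w, hw⟩ := hκ.exists_hasEigenvector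
  have hwe : A.mulVec w = κ • (w : Fin 4 → ℂ) := congrArg Subtype.val hw.apply_eq_smul
  have hw0 : (w : Fin 4 → ℂ) ≠ 0 := fun h => hw.2 (Subtype.ext h)
  obtain ⟨N, hN⟩ : ∃ N : ℝ, N = ∑ i, ‖(w : Fin 4 → ℂ) i‖ ^ 2 := ⟨_, rfl⟩
  have hdot : star (w : Fin 4 → ℂ) ⬝ᵥ (w : Fin 4 → ℂ) = N := by
    rw [hN, dotProduct, Complex.ofReal_sum]
    refine Finset.sum_congr rfl fun i _ => ?_
    rw [Pi.star_apply, Complex.star_def, Complex.conj_mul', Complex.ofReal_pow]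
  have hNpos : 0 < N := by
    obtain ⟨i, hi⟩ := Function.ne_iff.1 hw0
    rw [hN]
    exact Finset.sum_pos' (fun i _ => by positivity)
      ⟨i, Finset.mem_univ i, by have := norm_pos_iff.2 hi; positivity⟩
  have hNc : (N : ℂ) ≠ 0 := by exact_mod_cast hNpos.ne'
  refine ⟨((Real.sqrt N)⁻¹ : ℂ) • (w : Fin 4 → ℂ), W.smul_mem _ w.2, κ, ?_, ?_, ?_⟩
  · have h := star_mulVec_dotProduct_mulVec hA (w : Fin 4 → ℂ) w
    rw [hwe, star_smul, smul_dotProduct, dotProduct_smul, hdot, smul_eq_mul, smul_eq_mul,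
      ← mul_assoc, Complex.star_def, Complex.conj_mul'] at h
    have h' := mul_right_cancel₀ hNc (h.trans (one_mul _).symm)
    have : ‖κ‖ ^ 2 = 1 := by exact_mod_cast h'
    exact (pow_eq_one_iff_of_nonneg (norm_nonneg κ) two_ne_zero).1 this
  · rw [star_smul, smul_dotProduct, dotProduct_smul, hdot, smul_eq_mul, smul_eq_mul,
      ← Complex.ofReal_inv, Complex.star_def, Complex.conj_ofReal, ← mul_assoc,
      ← Complex.ofReal_mul, ← mul_inv, Real.mul_self_sqrt hNpos.le, Complex.ofReal_inv,
      inv_mul_cancel₀ hNc]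
  · rw [Matrix.mulVec_smul, hwe, smul_comm]

theorem exists_unit_eigenvector_arccos {A : Matrix (Fin 4) (Fin 4) ℂ} (hA : A ∈ USp4)
    {W : Submodule ℂ (Fin 4 → ℂ)} (hW : W ≠ ⊥) (hAW : ∀ v ∈ W, A.mulVec v ∈ W)
    (hqW : ∀ v ∈ W, quatConj v ∈ W) :
    ∃ v ∈ W, ∃ x ∈ Set.Icc (-1 : ℝ) 1, star v ⬝ᵥ v = 1 ∧
      A.mulVec v = Complex.exp (Real.arccos x * Complex.I) • v := by
  obtain ⟨v, hv, κ, hκ, hvv, hAv⟩ := exists_unit_eigenvector hA hW hAW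
  have hre : κ.re ∈ Set.Icc (-1 : ℝ) 1 := abs_le.1 (hκ ▸ Complex.abs_re_le_norm κ)
  rcases le_total 0 κ.im with h | h
  · exact ⟨v, hv, κ.re, hre, hvv, by rw [← eq_exp_arccos_of_norm_eq_one hκ h, hAv]⟩
  · refine ⟨quatConj v, hqW v hv, κ.re, hre, by rw [star_quatConj_dotProduct_self, hvv], ?_⟩
    have := eq_exp_arccos_of_norm_eq_one (κ := star κ) (by rw [norm_star, hκ]) (by simpa using h)
    rw [mulVec_quatConj hA, hAv, quatConj_smul, this]
    simp

/-- The matrix with columns `v, quatConj v, u, quatConj u`. -/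
noncomputable def quatFrame (v u : Fin 4 → ℂ) : Matrix (Fin 4) (Fin 4) ℂ :=
  Matrix.of fun i j => ![v i, quatConj v i, u i, quatConj u i] j

theorem quatFrame_mem_USp4 {v u : Fin 4 → ℂ} (hv : star v ⬝ᵥ v = 1) (hu : star u ⬝ᵥ u = 1)
    (h1 : star v ⬝ᵥ u = 0) (h2 : star (quatConj v) ⬝ᵥ u = 0) : quatFrame v u ∈ USp4 := by
  have h1' := congrArg (starRingEnd ℂ) h1
  have h2' := congrArg (starRingEnd ℂ) h2
  rw [quatConj_eq] at h2 h2'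
  simp [dotProduct, Fin.sum_univ_four] at hv hu h1 h2 h1' h2'
  constructor
  · rw [Matrix.mem_unitaryGroup_iff']
    ext i j
    fin_cases i <;> fin_cases j <;>
      simp [quatFrame, quatConj_eq, Matrix.star_eq_conjTranspose, Matrix.mul_apply,
        Fin.sum_univ_four] <;>
      first
        | ring1
        | linear_combination hv
        | linear_combination hu
        | linear_combination h1
        | linear_combination h2
        | linear_combination h1'
        | linear_combination h2'
        | linear_combination -h1
        | linear_combination -h2
        | linear_combination -h1'
        | linear_combination -h2'
  · ext i j
    fin_cases i <;> fin_cases j <;>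
      simp [quatFrame, quatConj_eq, Jmat, Matrix.mul_apply, Fin.sum_univ_four] <;>
      first
        | ring1
        | linear_combination hv
        | linear_combination hu
        | linear_combination -hv
        | linear_combination -hu
        | linear_combination h1
        | linear_combination h2
        | linear_combination h1'
        | linear_combination h2'
        | linear_combination -h1
        | linear_combination -h2
        | linear_combination -h1'
        | linear_combination -h2'

theorem exists_conj_uspDiag {A : Matrix (Fin 4) (Fin 4) ℂ} (hA : A ∈ USp4) :
    ∃ x ∈ Set.Icc (-1 : ℝ) 1, ∃ y ∈ Set.Icc (-1 : ℝ) 1, ∃ B ∈ USp4,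
      A = B * uspDiag (Real.arccos x) (Real.arccos y) * B⁻¹ := by
  obtain ⟨v, -, x, hx, hvv, hAv⟩ := exists_unit_eigenvector_arccos hA (W := ⊤) top_ne_bot
    (fun _ _ => trivial) (fun _ _ => trivial)
  have hconj : ∀ z : ℝ, star (Complex.exp (z * Complex.I)) = Complex.exp (-z * Complex.I) :=
    fun z => by rw [Complex.star_def, ← Complex.exp_conj]; simp
  have hAq : ∀ (w : Fin 4 → ℂ) (z : ℝ), A.mulVec w = Complex.exp (z * Complex.I) • w →
      A.mulVec (quatConj w) = Complex.exp (-z * Complex.I) • quatConj w := fun w z h => by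
    rw [mulVec_quatConj hA, h, quatConj_smul, hconj]
  obtain ⟨L, hL⟩ : ∃ L : (Fin 4 → ℂ) →ₗ[ℂ] (Fin 2 → ℂ),
      L = Matrix.mulVecLin (Matrix.of ![star v, star (quatConj v)]) := ⟨_, rfl⟩
  have hker : ∀ w, w ∈ LinearMap.ker L ↔ star v ⬝ᵥ w = 0 ∧ star (quatConj v) ⬝ᵥ w = 0 := by
    intro w
    rw [LinearMap.mem_ker, hL, funext_iff, Fin.forall_fin_two]
    exact Iff.rfl
  have horth : ∀ (p w : Fin 4 → ℂ) (c : ℂ), c ≠ 0 → A.mulVec p = c • p → star p ⬝ᵥ w = 0 →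
      star p ⬝ᵥ A.mulVec w = 0 := by
    intro p w c hc hp hw
    have h := star_mulVec_dotProduct_mulVec hA p w
    rw [hp, star_smul, smul_dotProduct, hw, smul_eq_mul] at h
    exact (mul_eq_zero.1 h).resolve_left (star_ne_zero.2 hc)
  obtain ⟨u, hu, y, hy, huu, hAu⟩ := exists_unit_eigenvector_arccos hA (W := LinearMap.ker L)
    (LinearMap.ker_ne_bot_of_finrank_lt (by simp))
    (fun w hw => by
      rw [hker] at hw ⊢
      exact ⟨horth v w _ (Complex.exp_ne_zero _) hAv hw.1,
        horth _ w _ (Complex.exp_ne_zero _) (hAq v _ hAv) hw.2⟩)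
    (fun w hw => by
      rw [hker] at hw ⊢
      have h1' := congrArg (starRingEnd ℂ) hw.1
      have h2' := congrArg (starRingEnd ℂ) hw.2
      rw [quatConj_eq] at h2' ⊢
      rw [quatConj_eq]
      simp [dotProduct, Fin.sum_univ_four] at h1' h2' ⊢
      exact ⟨by linear_combination -h2', by linear_combination h1'⟩)
  rw [hker] at hu
  have hB := quatFrame_mem_USp4 hvv huu hu.1 hu.2
  refine ⟨x, hx, y, hy, quatFrame v u, hB, ?_⟩
  have hAB : A * quatFrame v u =
      quatFrame v u * uspDiag (Real.arccos x) (Real.arccos y) := by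
    ext i j
    rw [uspDiag, Matrix.mul_diagonal]
    have e1 := congrFun hAv i
    have e2 := congrFun (hAq v _ hAv) i
    have e3 := congrFun hAu i
    have e4 := congrFun (hAq u _ hAu) i
    simp only [Pi.smul_apply, smul_eq_mul, Matrix.mulVec, dotProduct] at e1 e2 e3 e4
    fin_cases j
    · simpa [quatFrame, Matrix.mul_apply, mul_comm] using e1
    · simpa [quatFrame, Matrix.mul_apply, mul_comm] using e2
    · simpa [quatFrame, Matrix.mul_apply, mul_comm] using e3
    · simpa [quatFrame, Matrix.mul_apply, mul_comm] using e4
  rw [← hAB, inv_eq_star_of_mem_USp4 hB, Matrix.mul_assoc, mul_star_self_of_mem_USp4 hB, mul_one]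

/-! ### Determinacy of moments in the plane -/

theorem integrable_of_continuous_of_isCompact {X E : Type*} [TopologicalSpace X]
    [MeasurableSpace X] [BorelSpace X] [T2Space X] [NormedAddCommGroup E]
    [SecondCountableTopology E] {ν : Measure X} [IsFiniteMeasure ν] {K : Set X}
    (hK : IsCompact K) (hν : ν Kᶜ = 0) {g : X → E} (hg : Continuous g) : Integrable g ν := by
  borelize E
  obtain ⟨C, hC⟩ := hK.exists_bound_of_continuousOn hg.continuousOn
  refine Integrable.of_bound hg.measurable.aestronglyMeasurable C ?_
  filter_upwards [compl_mem_ae_iff.2 hν] with x hx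
  exact hC x (not_not.1 hx)

theorem measure_ext_of_moments {ν₁ ν₂ : Measure (ℝ × ℝ)} [IsFiniteMeasure ν₁]
    [IsFiniteMeasure ν₂] {K : Set (ℝ × ℝ)} (hK : IsCompact K) (h₁ : ν₁ Kᶜ = 0) (h₂ : ν₂ Kᶜ = 0)
    (h : ∀ i j : ℕ, ∫ z, z.1 ^ i * z.2 ^ j ∂ν₁ = ∫ z, z.1 ^ i * z.2 ^ j ∂ν₂) : ν₁ = ν₂ := by
  have hint₁ : ∀ g : C(ℝ × ℝ, ℝ), Integrable g ν₁ := fun g =>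
    integrable_of_continuous_of_isCompact hK h₁ g.continuous
  have hint₂ : ∀ g : C(ℝ × ℝ, ℝ), Integrable g ν₂ := fun g =>
    integrable_of_continuous_of_isCompact hK h₂ g.continuous
  obtain ⟨X, hX⟩ : ∃ X : C(ℝ × ℝ, ℝ), X = ⟨Prod.fst, continuous_fst⟩ := ⟨_, rfl⟩
  obtain ⟨Y, hY⟩ : ∃ Y : C(ℝ × ℝ, ℝ), Y = ⟨Prod.snd, continuous_snd⟩ := ⟨_, rfl⟩
  have hpoly : ∀ g ∈ Algebra.adjoin ℝ {X, Y}, ∫ z, g z ∂ν₁ = ∫ z, g z ∂ν₂ := by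
    intro g hg
    rw [← Subalgebra.mem_toSubmodule, Algebra.adjoin_eq_span] at hg
    induction hg using Submodule.span_induction with
    | mem g hg =>
      obtain ⟨i, j, rfl⟩ := (Submonoid.mem_closure_pair _ _ _).1 hg
      simpa [hX, hY] using h i j
    | zero => simp
    | add g g' _ _ hg hg' =>
      simp only [ContinuousMap.add_apply]
      rw [integral_add (hint₁ g) (hint₁ g'), integral_add (hint₂ g) (hint₂ g'), hg, hg']
    | smul c g _ hg =>
      simp only [ContinuousMap.smul_apply]
      rw [integral_smul, integral_smul, hg]
  have hsep : (Algebra.adjoin ℝ {X, Y}).SeparatesPoints := by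
    intro a b hab
    by_cases h1 : a.1 = b.1
    · refine ⟨Y, ⟨Y, Algebra.subset_adjoin (by simp), rfl⟩, fun h2 => hab (Prod.ext h1 ?_)⟩
      simpa [hY] using h2
    · exact ⟨X, ⟨X, Algebra.subset_adjoin (by simp), rfl⟩, by simpa [hX] using h1⟩
  refine ext_of_forall_integral_eq_of_IsFiniteMeasure fun φ => ?_
  have key : ∀ (ν : Measure (ℝ × ℝ)) [IsFiniteMeasure ν] (g : C(ℝ × ℝ, ℝ)) (ε : ℝ),
      ν Kᶜ = 0 → Integrable g ν → (∀ z ∈ K, ‖g z - φ z‖ < ε) →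
      |∫ z, φ z ∂ν - ∫ z, g z ∂ν| ≤ ε * ν.real Set.univ := by
    intro ν _ g ε hν hg hgε
    rw [← integral_sub (φ.integrable ν) hg, ← Real.norm_eq_abs]
    refine norm_integral_le_of_norm_le_const ?_
    filter_upwards [compl_mem_ae_iff.2 hν] with x hx
    rw [norm_sub_rev]
    exact (hgε x (not_not.1 hx)).le
  rw [← sub_eq_zero, ← abs_nonpos_iff]
  refine le_of_forall_pos_le_add fun δ hδ => ?_
  obtain ⟨T, hT⟩ : ∃ T : ℝ, T = ν₁.real Set.univ + ν₂.real Set.univ + 1 := ⟨_, rfl⟩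
  have hT0 : 0 < T := by
    have := measureReal_nonneg (μ := ν₁) (s := Set.univ)
    have := measureReal_nonneg (μ := ν₂) (s := Set.univ)
    linarith
  obtain ⟨g, hgA, hg⟩ :=
    ContinuousMap.exists_mem_subalgebra_near_continuous_of_isCompact_of_separatesPoints hsep
      φ.toContinuousMap hK (div_pos hδ hT0)
  have k1 := abs_le.1 (key ν₁ g _ h₁ (hint₁ g) hg)
  have k2 := abs_le.1 (key ν₂ g _ h₂ (hint₂ g) hg)
  have k3 := hpoly g hgA
  have k4 : δ / T * ν₁.real Set.univ + δ / T * ν₂.real Set.univ ≤ δ := by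
    rw [← mul_add, div_mul_eq_mul_div, div_le_iff₀ hT0]
    nlinarith
  rw [zero_add, abs_le]
  constructor <;> linarith

/-! ### The moment recurrence -/

/-- The recurrence satisfied by the moments `E[s ^ i * p ^ j]` when the expectation annihilates
the radial Laplacian of `USp(4)`, in the coordinates `s = cos θ₁ + cos θ₂`,
`p = cos θ₁ * cos θ₂`. -/
def MomentRecurrence (M : ℕ → ℕ → ℂ) : Prop :=
  ∀ i j : ℕ, ((i : ℂ) ^ 2 + 4 * i + 2 * i * j + 2 * j ^ 2 + 6 * j) * M i j =
    2 * i * (i - 1) * (M (i - 2) (j + 1) + M (i - 2) j) + 2 * i * j * M i (j - 1) +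
      j * (j - 1) * M (i + 2) (j - 2) - 2 * j ^ 2 * M i (j - 1)

theorem MomentRecurrence.unique {M N : ℕ → ℕ → ℂ} (hM : MomentRecurrence M)
    (hN : MomentRecurrence N) (h0 : M 0 0 = N 0 0) (i j : ℕ) : M i j = N i j := by
  by_cases hij : i = 0 ∧ j = 0
  · rw [hij.1, hij.2, h0]
  have hne : ((i : ℂ) ^ 2 + 4 * i + 2 * i * j + 2 * j ^ 2 + 6 * j) ≠ 0 := by
    have : i ^ 2 + 4 * i + 2 * i * j + 2 * j ^ 2 + 6 * j ≠ 0 := by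
      intro h
      apply hij
      constructor <;> nlinarith
    exact_mod_cast this
  have h1 : (i : ℂ) * (i - 1) * (M (i - 2) (j + 1) + M (i - 2) j) =
      i * (i - 1) * (N (i - 2) (j + 1) + N (i - 2) j) := by
    rcases Nat.lt_or_ge i 2 with hi | hi
    · interval_cases i <;> simp
    · rw [MomentRecurrence.unique hM hN h0 (i - 2) (j + 1),
        MomentRecurrence.unique hM hN h0 (i - 2) j]
  have h2 : (j : ℂ) * M i (j - 1) = j * N i (j - 1) := by
    rcases Nat.eq_zero_or_pos j with hj | hj
    · simp [hj]
    · rw [MomentRecurrence.unique hM hN h0 i (j - 1)]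
  have h3 : (j : ℂ) * (j - 1) * M (i + 2) (j - 2) = j * (j - 1) * N (i + 2) (j - 2) := by
    rcases Nat.lt_or_ge j 2 with hj | hj
    · interval_cases j <;> simp
    · rw [MomentRecurrence.unique hM hN h0 (i + 2) (j - 2)]
  apply mul_left_cancel₀ hne
  rw [hM i j, hN i j]
  linear_combination 2 * h1 + (2 * i - 2 * j) * h2 + h3
termination_by (i + j, j)
decreasing_by
  all_goals
    rw [Prod.lex_def]
    simp only
    omega

/-! ### The Weyl measure -/

/-- The radial Laplacian of `USp(4)` (up to a factor) applied to `s ^ i * p ^ j`. -/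
def radialLaplacian {R : Type*} [CommRing R] (i j : ℕ) (s p : R) : R :=
  2 * i * (i - 1) * (s ^ (i - 2) * p ^ (j + 1) + s ^ (i - 2) * p ^ j) +
    2 * i * j * (s ^ i * p ^ (j - 1)) + j * (j - 1) * (s ^ (i + 2) * p ^ (j - 2)) -
      2 * j ^ 2 * (s ^ i * p ^ (j - 1)) -
      ((i : R) ^ 2 + 4 * i + 2 * i * j + 2 * j ^ 2 + 6 * j) * (s ^ i * p ^ j)

/-- The density of the Weyl integration formula, without normalization. -/
noncomputable def weylDensity (a b : ℝ) : ℝ :=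
  (Real.cos a - Real.cos b) ^ 2 * Real.sin a ^ 2 * Real.sin b ^ 2

/-- The partial derivative with respect to `y` of `(x + y) ^ i * (x * y) ^ j`. -/
def dySymm (i j : ℕ) (x y : ℝ) : ℝ :=
  i * (x + y) ^ (i - 1) * (x * y) ^ j + (x + y) ^ i * (j * (x * y) ^ (j - 1) * x)

/-- The second partial derivative with respect to `y` of `(x + y) ^ i * (x * y) ^ j`. -/
def dyySymm (i j : ℕ) (x y : ℝ) : ℝ :=
  i * (i - 1) * (x + y) ^ (i - 2) * (x * y) ^ j +
    2 * i * j * (x + y) ^ (i - 1) * (x * y) ^ (j - 1) * x +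
    j * (j - 1) * (x + y) ^ i * (x * y) ^ (j - 2) * x ^ 2

/-- The part of the weighted radial Laplacian coming from the second angle, as a function of
`x = cos θ₁` and `y = cos θ₂`. -/
def weightedLaplacianPart (i j : ℕ) (x y : ℝ) : ℝ :=
  (1 - x ^ 2) * ((x - y) ^ 2 * (1 - y ^ 2) ^ 2 * dyySymm i j x y -
    (2 * (x - y) * (1 - y ^ 2) ^ 2 + 3 * (x - y) ^ 2 * (1 - y ^ 2) * y) * dySymm i j x y)

theorem weightedLaplacianPart_add_swap (i j : ℕ) (x y : ℝ) :
    weightedLaplacianPart i j x y + weightedLaplacianPart i j y x =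
      (x - y) ^ 2 * (1 - x ^ 2) * (1 - y ^ 2) * radialLaplacian i j (x + y) (x * y) := by
  rw [weightedLaplacianPart, weightedLaplacianPart, dySymm, dySymm, dyySymm, dyySymm,
    radialLaplacian, add_comm y x, mul_comm y x]
  rcases i with _ | _ | i <;> rcases j with _ | _ | j <;>
    simp only [Nat.add_sub_cancel, Nat.cast_zero, Nat.cast_add, Nat.cast_one, pow_succ, pow_zero,
      add_assoc, Nat.reduceAdd, Nat.zero_sub, Nat.reduceSub, zero_add, Nat.add_succ_sub_one] <;>
    ring

theorem hasDerivAt_dySymm (i j : ℕ) (x y : ℝ) :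
    HasDerivAt (fun y => dySymm i j x y) (dyySymm i j x y) y := by
  have hs : HasDerivAt (fun y : ℝ => x + y) 1 y := (hasDerivAt_id y).const_add x
  have hp : HasDerivAt (fun y : ℝ => x * y) (x * 1) y := (hasDerivAt_id y).const_mul x
  have h := (((hs.pow (i - 1)).const_mul (i : ℝ)).mul (hp.pow j)).add
    ((hs.pow i).mul (((hp.pow (j - 1)).const_mul (j : ℝ)).mul_const x))
  refine h.congr_deriv ?_
  rw [dyySymm]
  rcases i with _ | _ | i <;> rcases j with _ | _ | j <;> simp <;> ring

theorem integral_weightedLaplacianPart (i j : ℕ) (x : ℝ) :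
    ∫ b in (0 : ℝ)..Real.pi, weightedLaplacianPart i j x (Real.cos b) = 0 := by
  have hd : ∀ b : ℝ, HasDerivAt
      (fun b => -(1 - x ^ 2) * ((x - Real.cos b) ^ 2 * Real.sin b ^ 3 * dySymm i j x (Real.cos b)))
      (weightedLaplacianPart i j x (Real.cos b)) b := by
    intro b
    have hc := Real.hasDerivAt_cos b
    have h := (((((hc.const_sub x).pow 2).mul ((Real.hasDerivAt_sin b).pow 3)).mul
      ((hasDerivAt_dySymm i j x (Real.cos b)).comp b hc)).const_mul (-(1 - x ^ 2)))
    refine h.congr_deriv ?_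
    have e : Real.sin b ^ 2 = 1 - Real.cos b ^ 2 := Real.sin_sq b
    rw [weightedLaplacianPart, ← e]
    simp
    ring
  rw [intervalIntegral.integral_eq_sub_of_hasDerivAt (fun b _ => hd b)]
  · simp
  · apply Continuous.intervalIntegrable
    unfold weightedLaplacianPart dySymm dyySymm
    fun_prop

/-- The product of two copies of Lebesgue measure on `(0, π]`. -/
noncomputable def angleMeasure : Measure (ℝ × ℝ) :=
  (volume.restrict (Set.Ioc 0 Real.pi)).prod (volume.restrict (Set.Ioc 0 Real.pi))

instance : IsFiniteMeasure angleMeasure := by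
  unfold angleMeasure; infer_instance

theorem angleMeasure_compl :
    angleMeasure (Set.Icc (0 : ℝ) Real.pi ×ˢ Set.Icc (0 : ℝ) Real.pi)ᶜ = 0 := by
  rw [angleMeasure, Measure.prod_restrict,
    Measure.restrict_apply (measurableSet_Icc.prod measurableSet_Icc).compl]
  convert measure_empty (μ := (volume : Measure ℝ).prod volume)
  rw [← Set.disjoint_iff_inter_eq_empty]
  exact Set.disjoint_compl_left_iff_subset.2
    (Set.prod_mono Set.Ioc_subset_Icc_self Set.Ioc_subset_Icc_self)

theorem integrable_angleMeasure {E : Type*} [NormedAddCommGroup E] [SecondCountableTopology E]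
    {g : ℝ × ℝ → E} (hg : Continuous g) : Integrable g angleMeasure :=
  integrable_of_continuous_of_isCompact (isCompact_Icc.prod isCompact_Icc) angleMeasure_compl hg

theorem integral_angleMeasure {E : Type*} [NormedAddCommGroup E] [NormedSpace ℝ E]
    [SecondCountableTopology E] {g : ℝ × ℝ → E} (hg : Continuous g) :
    ∫ z, g z ∂angleMeasure =
      ∫ a in (0 : ℝ)..Real.pi, ∫ b in (0 : ℝ)..Real.pi, g (a, b) := by
  have h := integrable_angleMeasure hg
  rw [angleMeasure] at h ⊢
  rw [integral_prod _ h, intervalIntegral.integral_of_le Real.pi_pos.le]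
  simp only [intervalIntegral.integral_of_le Real.pi_pos.le]

theorem integral_angleMeasure_swap {E : Type*} [NormedAddCommGroup E] [NormedSpace ℝ E]
    (g : ℝ × ℝ → E) : ∫ z, g z.swap ∂angleMeasure = ∫ z, g z ∂angleMeasure :=
  integral_prod_swap g

/-- The measure on pairs of angles appearing in the Weyl integration formula. -/
noncomputable def weylMeasure : Measure (ℝ × ℝ) :=
  angleMeasure.withDensity fun z => ENNReal.ofReal (8 / Real.pi ^ 2 * weylDensity z.1 z.2)

theorem continuous_weylDensity : Continuous fun z : ℝ × ℝ => weylDensity z.1 z.2 := by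
  unfold weylDensity; fun_prop

theorem weylDensity_nonneg (a b : ℝ) : 0 ≤ weylDensity a b := by
  unfold weylDensity; positivity

theorem weylMeasure_compl :
    weylMeasure (Set.Icc (0 : ℝ) Real.pi ×ˢ Set.Icc (0 : ℝ) Real.pi)ᶜ = 0 :=
  withDensity_absolutelyContinuous _ _ angleMeasure_compl

instance : IsFiniteMeasure weylMeasure := by
  refine isFiniteMeasure_withDensity_ofReal (Integrable.hasFiniteIntegral ?_)
  exact integrable_angleMeasure (continuous_weylDensity.const_mul _)

theorem integral_weylMeasure {E : Type*} [NormedAddCommGroup E] [NormedSpace ℝ E]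
    (g : ℝ × ℝ → E) :
    ∫ z, g z ∂weylMeasure =
      (8 / Real.pi ^ 2) • ∫ z, weylDensity z.1 z.2 • g z ∂angleMeasure := by
  have hm : Measurable fun z : ℝ × ℝ => 8 / Real.pi ^ 2 * weylDensity z.1 z.2 :=
    (continuous_weylDensity.const_mul _).measurable
  rw [weylMeasure, integral_withDensity_eq_integral_toReal_smul hm.ennreal_ofReal
    (Filter.Eventually.of_forall fun _ => ENNReal.ofReal_lt_top), ← integral_smul]
  refine integral_congr_ae (Filter.Eventually.of_forall fun z => ?_)
  have : 0 ≤ 8 / Real.pi ^ 2 * weylDensity z.1 z.2 :=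
    mul_nonneg (by positivity) (weylDensity_nonneg _ _)
  simp only [ENNReal.toReal_ofReal this, mul_smul]

theorem integral_weylDensity : ∫ z, weylDensity z.1 z.2 ∂angleMeasure = Real.pi ^ 2 / 8 := by
  have h1 : ∫ b in (0 : ℝ)..Real.pi, Real.sin b ^ 2 = Real.pi / 2 := by simp [integral_sin_sq]
  have h2 : ∫ b in (0 : ℝ)..Real.pi, Real.sin b ^ 2 * Real.cos b = 0 := by
    simp [integral_sin_sq_mul_cos]
  have h3 : ∫ b in (0 : ℝ)..Real.pi, Real.sin b ^ 2 * Real.cos b ^ 2 = Real.pi / 8 := by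
    have : Real.sin (4 * Real.pi) = 0 := by exact_mod_cast Real.sin_nat_mul_pi 4
    simp [integral_sin_sq_mul_cos_sq, this]
  rw [integral_angleMeasure continuous_weylDensity]
  have hin : ∀ a, ∫ b in (0 : ℝ)..Real.pi, weylDensity a b =
      Real.pi / 2 * (Real.sin a ^ 2 * Real.cos a ^ 2) + Real.pi / 8 * Real.sin a ^ 2 := by
    intro a
    have he : ∀ b, weylDensity a b = Real.sin a ^ 2 * Real.cos a ^ 2 * Real.sin b ^ 2 -
        2 * Real.sin a ^ 2 * Real.cos a * (Real.sin b ^ 2 * Real.cos b) +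
        Real.sin a ^ 2 * (Real.sin b ^ 2 * Real.cos b ^ 2) := fun b => by
      unfold weylDensity; ring
    simp only [he]
    rw [intervalIntegral.integral_add, intervalIntegral.integral_sub,
      intervalIntegral.integral_const_mul, intervalIntegral.integral_const_mul,
      intervalIntegral.integral_const_mul, h1, h2, h3]
    · ring
    all_goals
      apply Continuous.intervalIntegrable
      fun_prop
  simp only [hin]
  rw [intervalIntegral.integral_add, intervalIntegral.integral_const_mul,
    intervalIntegral.integral_const_mul, h1, h3]
  · ring
  all_goals
    apply Continuous.intervalIntegrable
    fun_prop

theorem integral_radialLaplacian_weylMeasure (i j : ℕ) :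
    ∫ z, radialLaplacian i j (Real.cos z.1 + Real.cos z.2) (Real.cos z.1 * Real.cos z.2)
      ∂weylMeasure = 0 := by
  have hc : Continuous fun z : ℝ × ℝ =>
      weightedLaplacianPart i j (Real.cos z.1) (Real.cos z.2) := by
    unfold weightedLaplacianPart dySymm dyySymm
    fun_prop
  have hc' : Continuous fun z : ℝ × ℝ =>
      weightedLaplacianPart i j (Real.cos z.2) (Real.cos z.1) := by
    unfold weightedLaplacianPart dySymm dyySymm
    fun_prop
  have h0 : ∫ z, weightedLaplacianPart i j (Real.cos z.1) (Real.cos z.2) ∂angleMeasure = 0 := by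
    rw [integral_angleMeasure hc]
    simp only [integral_weightedLaplacianPart, intervalIntegral.integral_zero]
  have h1 : ∫ z, weightedLaplacianPart i j (Real.cos z.2) (Real.cos z.1) ∂angleMeasure = 0 :=
    (integral_angleMeasure_swap fun z : ℝ × ℝ =>
      weightedLaplacianPart i j (Real.cos z.1) (Real.cos z.2)).trans h0
  rw [integral_weylMeasure]
  have he : ∀ z : ℝ × ℝ, weylDensity z.1 z.2 •
      radialLaplacian i j (Real.cos z.1 + Real.cos z.2) (Real.cos z.1 * Real.cos z.2) =
      weightedLaplacianPart i j (Real.cos z.1) (Real.cos z.2) +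
        weightedLaplacianPart i j (Real.cos z.2) (Real.cos z.1) := fun z => by
    rw [weightedLaplacianPart_add_swap, weylDensity, Real.sin_sq, Real.sin_sq, smul_eq_mul]
  simp only [he]
  rw [integral_add (integrable_angleMeasure hc) (integrable_angleMeasure hc'), h0, h1, add_zero,
    smul_zero]

theorem momentRecurrence_of_integral_radialLaplacian {X : Type*} [TopologicalSpace X]
    [MeasurableSpace X] [BorelSpace X] [T2Space X] {ν : Measure X} [IsFiniteMeasure ν] {K : Set X}
    (hK : IsCompact K) (hν : ν Kᶜ = 0) {S P : X → ℂ} (hS : Continuous S) (hP : Continuous P)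
    (h : ∀ i j : ℕ, ∫ x, radialLaplacian i j (S x) (P x) ∂ν = 0) :
    MomentRecurrence fun i j => ∫ x, S x ^ i * P x ^ j ∂ν := by
  intro i j
  have hm : ∀ k l : ℕ, Integrable (fun x => S x ^ k * P x ^ l) ν := fun k l =>
    integrable_of_continuous_of_isCompact hK hν ((hS.pow k).mul (hP.pow l))
  have e := h i j
  simp only [radialLaplacian] at e
  rw [integral_sub, integral_sub, integral_add, integral_add] at e
  · simp only [integral_const_mul] at e
    rw [integral_add (hm _ _) (hm _ _)] at e
    linear_combination -e
  all_goals
    have h1 := fun c k l => (hm k l).const_mul c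
    have h2 := fun c k l k' l' => ((hm k l).add (hm k' l')).const_mul c
    first
    | exact h1 _ _ _
    | exact h2 _ _ _ _ _
    | exact (h2 _ _ _ _ _).add (h1 _ _ _)
    | exact ((h2 _ _ _ _ _).add (h1 _ _ _)).add (h1 _ _ _)
    | exact (((h2 _ _ _ _ _).add (h1 _ _ _)).add (h1 _ _ _)).sub (h1 _ _ _)

/-! ### Integration by parts on `USp(4)` -/

/-- A basis of the Lie algebra of `USp(4)`, orthogonal for the trace form, consisting of complex
structures. -/
noncomputable def spBasis : Fin 10 → Matrix (Fin 4) (Fin 4) ℂ :=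
  ![!![Complex.I, 0, 0, 0; 0, -Complex.I, 0, 0; 0, 0, Complex.I, 0; 0, 0, 0, -Complex.I],
    !![Complex.I, 0, 0, 0; 0, -Complex.I, 0, 0; 0, 0, -Complex.I, 0; 0, 0, 0, Complex.I],
    !![0, 1, 0, 0; -1, 0, 0, 0; 0, 0, 0, 1; 0, 0, -1, 0],
    !![0, 1, 0, 0; -1, 0, 0, 0; 0, 0, 0, -1; 0, 0, 1, 0],
    !![0, Complex.I, 0, 0; Complex.I, 0, 0, 0; 0, 0, 0, Complex.I; 0, 0, Complex.I, 0],
    !![0, Complex.I, 0, 0; Complex.I, 0, 0, 0; 0, 0, 0, -Complex.I; 0, 0, -Complex.I, 0],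
    !![0, 0, 1, 0; 0, 0, 0, 1; -1, 0, 0, 0; 0, -1, 0, 0],
    !![0, 0, Complex.I, 0; 0, 0, 0, -Complex.I; Complex.I, 0, 0, 0; 0, -Complex.I, 0, 0],
    !![0, 0, 0, 1; 0, 0, -1, 0; 0, 1, 0, 0; -1, 0, 0, 0],
    !![0, 0, 0, Complex.I; 0, 0, Complex.I, 0; 0, Complex.I, 0, 0; Complex.I, 0, 0, 0]]

theorem spBasis_mul_self (n : Fin 10) : spBasis n * spBasis n = -1 := by
  ext i j
  fin_cases n <;> fin_cases i <;> fin_cases j <;>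
    simp [spBasis, Matrix.mul_apply, Fin.sum_univ_four]

theorem star_spBasis (n : Fin 10) : star (spBasis n) = -spBasis n := by
  ext i j
  fin_cases n <;> fin_cases i <;> fin_cases j <;> simp [spBasis]

theorem Jmat_mul_mul_Jmat (M : Matrix (Fin 4) (Fin 4) ℂ) : Jmat * M * Jmat =
    !![-M 1 1, M 1 0, -M 1 3, M 1 2; M 0 1, -M 0 0, M 0 3, -M 0 2;
      -M 3 1, M 3 0, -M 3 3, M 3 2; M 2 1, -M 2 0, M 2 3, -M 2 2] := by
  ext i j
  fin_cases i <;> fin_cases j <;>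
    simp [Jmat, Matrix.mul_apply, Matrix.vecMul, dotProduct, Fin.sum_univ_four]

theorem spBasis_transpose_mul_Jmat (n : Fin 10) :
    (spBasis n).transpose * Jmat = -(Jmat * spBasis n) := by
  have h : Jmat * (spBasis n).transpose * Jmat = spBasis n := by
    rw [Jmat_mul_mul_Jmat]
    ext i j
    fin_cases n <;> fin_cases i <;> fin_cases j <;> simp [spBasis]
  have h' := congrArg (Jmat * ·) h
  simp only [Matrix.mul_assoc] at h'
  rw [← Matrix.mul_assoc Jmat Jmat, Jmat_mul_Jmat, neg_mul, one_mul] at h'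
  rw [← h', neg_neg]

theorem sum_trace_spBasis_mul (M N : Matrix (Fin 4) (Fin 4) ℂ) :
    ∑ n, (spBasis n * M).trace * (spBasis n * N).trace =
      -2 * ((M * N).trace + (Jmat * M.transpose * Jmat * N).trace) := by
  rw [Jmat_mul_mul_Jmat]
  simp only [Fin.sum_univ_succ, Matrix.trace, Matrix.diag_apply, Matrix.mul_apply,
    Matrix.transpose_apply]
  simp [spBasis]
  ring_nf
  simp only [Complex.I_sq]
  ring

set_option maxHeartbeats 1000000 in
theorem sum_spBasis_conj (M : Matrix (Fin 4) (Fin 4) ℂ) :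
    ∑ n, spBasis n * M * spBasis n =
      (-2 : ℂ) • (M.trace • 1 - Jmat * M.transpose * Jmat) := by
  rw [Jmat_mul_mul_Jmat]
  ext i j
  simp only [Fin.sum_univ_succ, Matrix.add_apply, Matrix.mul_apply, Matrix.trace,
    Matrix.diag_apply]
  fin_cases i <;> fin_cases j <;> simp [spBasis] <;> ring_nf <;>
    simp only [Complex.I_sq] <;> ring

/-- The one-parameter group `exp (t X)` generated by a complex structure `X`. -/
noncomputable def matRotation (X : Matrix (Fin 4) (Fin 4) ℂ) (t : ℝ) : Matrix (Fin 4) (Fin 4) ℂ :=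
  Real.cos t • 1 + Real.sin t • X

theorem matRotation_add {X : Matrix (Fin 4) (Fin 4) ℂ} (hX : X * X = -1) (s t : ℝ) :
    matRotation X (s + t) = matRotation X s * matRotation X t := by
  simp only [matRotation, Real.cos_add, Real.sin_add, add_mul, mul_add, smul_mul_assoc,
    mul_smul_comm, hX, one_mul, mul_one]
  module

theorem matRotation_zero (X : Matrix (Fin 4) (Fin 4) ℂ) : matRotation X 0 = 1 := by
  simp [matRotation]

theorem matRotation_neg_mul_self {X : Matrix (Fin 4) (Fin 4) ℂ} (hX : X * X = -1) (t : ℝ) :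
    matRotation X (-t) * matRotation X t = 1 := by
  rw [← matRotation_add hX, neg_add_cancel, matRotation_zero]

theorem matRotation_spBasis_mem_USp4 (n : Fin 10) (t : ℝ) : matRotation (spBasis n) t ∈ USp4 := by
  have hr := matRotation_neg_mul_self (spBasis_mul_self n) t
  constructor
  · rw [Matrix.mem_unitaryGroup_iff', ← hr]
    simp [matRotation, star_spBasis, star_add, star_smul]
  · have h : (matRotation (spBasis n) t).transpose * Jmat = Jmat * matRotation (spBasis n) (-t) := by
      simp [matRotation, add_mul, mul_add, spBasis_transpose_mul_Jmat]
    rw [h, Matrix.mul_assoc, hr, mul_one]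

theorem integral_mul_left_eq_of_mem_USp4 [MeasurableSpace (Matrix (Fin 4) (Fin 4) ℂ)]
    [BorelSpace (Matrix (Fin 4) (Fin 4) ℂ)] {μ : Measure (Matrix (Fin 4) (Fin 4) ℂ)}
    (hinv : ∀ B ∈ USp4, μ.map (fun A => B * A) = μ) {F : Matrix (Fin 4) (Fin 4) ℂ → ℂ}
    (hF : Continuous F) {B : Matrix (Fin 4) (Fin 4) ℂ} (hB : B ∈ USp4) :
    ∫ A, F (B * A) ∂μ = ∫ A, F A ∂μ := by
  have hm : Continuous fun A : Matrix (Fin 4) (Fin 4) ℂ => B * A :=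
    continuous_const.matrix_mul continuous_id
  conv_rhs => rw [← hinv B hB]
  exact (integral_map hm.measurable.aemeasurable hF.measurable.aestronglyMeasurable).symm

/-- Integration by parts: the integral of a derivative along a one-parameter subgroup vanishes. -/
theorem integral_eq_zero_of_hasDerivAt_matRotation [MeasurableSpace (Matrix (Fin 4) (Fin 4) ℂ)]
    [BorelSpace (Matrix (Fin 4) (Fin 4) ℂ)] {μ : Measure (Matrix (Fin 4) (Fin 4) ℂ)}
    [IsFiniteMeasure μ] (hcarrier : μ USp4ᶜ = 0)
    (hinv : ∀ B ∈ USp4, μ.map (fun A => B * A) = μ) {F F' : Matrix (Fin 4) (Fin 4) ℂ → ℂ}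
    (hF : Continuous F) (hF' : Continuous F') {n : Fin 10}
    (hd : ∀ A, HasDerivAt (fun t => F (matRotation (spBasis n) t * A)) (F' A) 0) :
    ∫ A, F' A ∂μ = 0 := by
  have hm : ∀ t, Continuous fun A : Matrix (Fin 4) (Fin 4) ℂ => matRotation (spBasis n) t * A :=
    fun t => continuous_const.matrix_mul continuous_id
  obtain ⟨C, hC⟩ := isCompact_USp4.exists_bound_of_continuousOn hF'.continuousOn
  have hd' : ∀ A t, HasDerivAt (fun t => F (matRotation (spBasis n) t * A))
      (F' (matRotation (spBasis n) t * A)) t := by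
    intro A t
    have h := hd (matRotation (spBasis n) t * A)
    rw [← sub_self t] at h
    refine (h.comp_sub_const t t).congr_of_eventuallyEq (Filter.Eventually.of_forall fun u => ?_)
    simp only [← Matrix.mul_assoc, ← matRotation_add (spBasis_mul_self n), sub_add_cancel]
  have key := hasDerivAt_integral_of_dominated_loc_of_deriv_le (μ := μ) (x₀ := (0 : ℝ))
    (s := Set.univ) (F := fun t A => F (matRotation (spBasis n) t * A))
    (F' := fun t A => F' (matRotation (spBasis n) t * A)) (bound := fun _ => C)
    Filter.univ_mem
    (Filter.Eventually.of_forall fun t => (hF.comp (hm t)).measurable.aestronglyMeasurable)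
    (integrable_of_continuous_of_isCompact isCompact_USp4 hcarrier (hF.comp (hm 0)))
    (hF'.comp (hm 0)).measurable.aestronglyMeasurable
    (by
      filter_upwards [compl_mem_ae_iff.2 hcarrier] with A hA t _
      exact hC _ (mul_mem_USp4 (matRotation_spBasis_mem_USp4 n t) (not_not.1 hA)))
    (integrable_const C) (Filter.Eventually.of_forall fun A t _ => hd' A t)
  have hconst : (fun t => ∫ A, F (matRotation (spBasis n) t * A) ∂μ) = fun _ => ∫ A, F A ∂μ :=
    funext fun t => integral_mul_left_eq_of_mem_USp4 hinv hF (matRotation_spBasis_mem_USp4 n t)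
  have h0 := key.2
  rw [hconst] at h0
  have h1 := h0.unique (hasDerivAt_const _ _)
  simpa [matRotation_zero] using h1

/-! ### The radial Laplacian on `USp(4)` -/

/-- On `USp(4)`, the sum `cos θ₁ + cos θ₂` over the eigenangles. -/
noncomputable def cosSum (A : Matrix (Fin 4) (Fin 4) ℂ) : ℂ := A.trace / 2

/-- On `USp(4)`, the product `cos θ₁ * cos θ₂` over the eigenangles. -/
noncomputable def cosProd (A : Matrix (Fin 4) (Fin 4) ℂ) : ℂ :=
  cosSum A ^ 2 / 2 - (A * A).trace / 8 - 1 / 2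

/-- The derivative of `cosSum` in the direction `X`. -/
noncomputable def cosSumDeriv (X A : Matrix (Fin 4) (Fin 4) ℂ) : ℂ := (X * A).trace / 2

/-- The derivative of `cosProd` in the direction `X`. -/
noncomputable def cosProdDeriv (X A : Matrix (Fin 4) (Fin 4) ℂ) : ℂ :=
  cosSum A * cosSumDeriv X A - (X * (A * A)).trace / 4

/-- The second derivative of `cosProd` in the direction `X`. -/
noncomputable def cosProdDeriv2 (X A : Matrix (Fin 4) (Fin 4) ℂ) : ℂ :=
  cosSumDeriv X A ^ 2 - cosSum A ^ 2 + ((A * A).trace - (X * A * X * A).trace) / 4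

/-- The first derivative of `s ^ i * p ^ j` along a curve, where `a` and `b` are the first
derivatives of `s` and `p`. -/
def monomialDeriv (i j : ℕ) (s p a b : ℂ) : ℂ :=
  i * s ^ (i - 1) * p ^ j * a + j * (s ^ i * p ^ (j - 1)) * b

/-- The second derivative of `s ^ i * p ^ j` along a curve, where `a` and `b` are the first
derivatives of `s` and `p`, and `a'` and `b'` are the second ones. -/
def monomialDeriv2 (i j : ℕ) (s p a b a' b' : ℂ) : ℂ :=
  i * (i - 1) * (s ^ (i - 2) * p ^ j) * a ^ 2 +
    2 * i * j * (s ^ (i - 1) * p ^ (j - 1)) * (a * b) +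
    j * (j - 1) * (s ^ i * p ^ (j - 2)) * b ^ 2 +
    i * (s ^ (i - 1) * p ^ j) * a' + j * (s ^ i * p ^ (j - 1)) * b'

theorem HasDerivAt.monomialDeriv {s p a b : ℝ → ℂ} {a' b' : ℂ} {t : ℝ}
    (hs : HasDerivAt s (a t) t) (hp : HasDerivAt p (b t) t) (ha : HasDerivAt a a' t)
    (hb : HasDerivAt b b' t) (i j : ℕ) :
    HasDerivAt (fun u => monomialDeriv i j (s u) (p u) (a u) (b u))
      (monomialDeriv2 i j (s t) (p t) (a t) (b t) a' b') t := by
  have h := (((hs.pow (i - 1)).const_mul (i : ℂ)).mul (hp.pow j)).mul ha |>.add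
    ((((hs.pow i).mul (hp.pow (j - 1))).const_mul (j : ℂ)).mul hb)
  refine h.congr_deriv ?_
  simp only [monomialDeriv2, Pi.mul_apply, Pi.pow_apply]
  rcases i with _ | _ | i <;> rcases j with _ | _ | j <;>
    simp only [Nat.add_sub_cancel, Nat.cast_zero, Nat.cast_add, Nat.cast_one, pow_succ, pow_zero,
      add_assoc, Nat.reduceAdd, Nat.zero_sub, Nat.reduceSub, zero_add, Nat.add_succ_sub_one] <;>
    ring

theorem hasDerivAt_ofReal_cos (t : ℝ) :
    HasDerivAt (fun t : ℝ => (Real.cos t : ℂ)) (-(Real.sin t : ℂ)) t := by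
  simpa using (Real.hasDerivAt_cos t).ofReal_comp

theorem hasDerivAt_ofReal_sin (t : ℝ) :
    HasDerivAt (fun t : ℝ => (Real.sin t : ℂ)) (Real.cos t : ℂ) t :=
  (Real.hasDerivAt_sin t).ofReal_comp

section Curve

variable {X : Matrix (Fin 4) (Fin 4) ℂ} (A : Matrix (Fin 4) (Fin 4) ℂ)

theorem hasDerivAt_trace_mul_matRotation (Y : Matrix (Fin 4) (Fin 4) ℂ) :
    HasDerivAt (fun t => (Y * (matRotation X t * A)).trace) (Y * (X * A)).trace 0 := by
  have h := ((hasDerivAt_ofReal_cos 0).mul_const (Y * A).trace).add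
    ((hasDerivAt_ofReal_sin 0).mul_const (Y * (X * A)).trace)
  simp only [Real.sin_zero, Real.cos_zero, Complex.ofReal_zero, Complex.ofReal_one, neg_zero,
    zero_mul, one_mul, zero_add] at h
  refine h.congr_of_eventuallyEq (Filter.Eventually.of_forall fun t => ?_)
  simp [matRotation, add_mul, mul_add]

theorem hasDerivAt_trace_mul_matRotation_sq (Y : Matrix (Fin 4) (Fin 4) ℂ) :
    HasDerivAt (fun t => (Y * (matRotation X t * A * (matRotation X t * A))).trace)
      ((Y * (X * A * A)).trace + (Y * (A * (X * A))).trace) 0 := by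
  have hc := hasDerivAt_ofReal_cos 0
  have hs := hasDerivAt_ofReal_sin 0
  have h := (((hc.mul hc).mul_const (Y * (A * A)).trace).add
    ((hc.mul hs).mul_const ((Y * (X * A * A)).trace + (Y * (A * (X * A))).trace))).add
    ((hs.mul hs).mul_const (Y * (X * A * (X * A))).trace)
  simp only [Real.sin_zero, Real.cos_zero, Complex.ofReal_zero, Complex.ofReal_one, neg_zero,
    zero_mul, one_mul, zero_add, mul_zero, add_zero] at h
  refine h.congr_of_eventuallyEq (Filter.Eventually.of_forall fun t => ?_)
  simp [matRotation, add_mul, mul_add]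
  ring

theorem hasDerivAt_cosSum_matRotation :
    HasDerivAt (fun t => cosSum (matRotation X t * A)) (cosSumDeriv X A) 0 := by
  have h := (hasDerivAt_trace_mul_matRotation (X := X) A 1).div_const 2
  simp only [one_mul] at h
  exact h

theorem hasDerivAt_cosProd_matRotation :
    HasDerivAt (fun t => cosProd (matRotation X t * A)) (cosProdDeriv X A) 0 := by
  have h := ((((hasDerivAt_cosSum_matRotation (X := X) A).pow 2).div_const 2).sub
    ((hasDerivAt_trace_mul_matRotation_sq (X := X) A 1).div_const 8)).sub_const (1 / 2)
  simp only [one_mul] at h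
  refine h.congr_deriv ?_
  rw [Matrix.trace_mul_comm A (X * A), matRotation_zero, one_mul, cosProdDeriv, Matrix.mul_assoc]
  push_cast
  ring

theorem hasDerivAt_cosSumDeriv_matRotation (hX : X * X = -1) :
    HasDerivAt (fun t => cosSumDeriv X (matRotation X t * A)) (-cosSum A) 0 := by
  have h := (hasDerivAt_trace_mul_matRotation (X := X) A X).div_const 2
  refine h.congr_deriv ?_
  rw [← Matrix.mul_assoc, hX, neg_mul, one_mul, Matrix.trace_neg, cosSum, neg_div]

theorem hasDerivAt_cosProdDeriv_matRotation (hX : X * X = -1) :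
    HasDerivAt (fun t => cosProdDeriv X (matRotation X t * A)) (cosProdDeriv2 X A) 0 := by
  have h := ((hasDerivAt_cosSum_matRotation (X := X) A).mul
    (hasDerivAt_cosSumDeriv_matRotation A hX)).sub
    ((hasDerivAt_trace_mul_matRotation_sq (X := X) A X).div_const 4)
  refine h.congr_deriv ?_
  have e : X * (X * A * A) = -(A * A) := by
    rw [← Matrix.mul_assoc, ← Matrix.mul_assoc, hX, neg_mul, one_mul, neg_mul]
  rw [e, Matrix.trace_neg, matRotation_zero, one_mul, cosProdDeriv2, ← Matrix.mul_assoc X A,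
    ← Matrix.mul_assoc (X * A)]
  ring

end Curve

theorem uspDiag_mul_uspDiag (a b c d : ℝ) :
    uspDiag a b * uspDiag c d = uspDiag (a + c) (b + d) := by
  rw [uspDiag, uspDiag, uspDiag, Matrix.diagonal_mul_diagonal]
  congr 1
  ext i
  fin_cases i <;> simp [← Complex.exp_add] <;> ring_nf

theorem trace_uspDiag (a b : ℝ) :
    (uspDiag a b).trace = 2 * (Real.cos a + Real.cos b : ℝ) := by
  simp [uspDiag, Matrix.trace, Fin.sum_univ_four, Complex.cos]
  ring

theorem cosSum_uspDiag (a b : ℝ) : cosSum (uspDiag a b) = (Real.cos a + Real.cos b : ℝ) := by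
  rw [cosSum, trace_uspDiag, mul_div_cancel_left₀ _ two_ne_zero]

theorem cosProd_uspDiag (a b : ℝ) : cosProd (uspDiag a b) = (Real.cos a * Real.cos b : ℝ) := by
  rw [cosProd, cosSum_uspDiag, uspDiag_mul_uspDiag, trace_uspDiag, ← two_mul, ← two_mul,
    Real.cos_two_mul, Real.cos_two_mul]
  push_cast
  ring

theorem isUnit_det_of_mem_USp4 {B : Matrix (Fin 4) (Fin 4) ℂ} (hB : B ∈ USp4) : IsUnit B.det :=
  (Matrix.isUnit_iff_isUnit_det B).1
    (IsUnit.of_mul_eq_one_right _ (star_mul_self_of_mem_USp4 hB))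

theorem trace_conj_of_mem_USp4 {B : Matrix (Fin 4) (Fin 4) ℂ} (hB : B ∈ USp4)
    (D : Matrix (Fin 4) (Fin 4) ℂ) : (B * D * B⁻¹).trace = D.trace := by
  rw [Matrix.trace_mul_comm, ← Matrix.mul_assoc,
    Matrix.nonsing_inv_mul _ (isUnit_det_of_mem_USp4 hB), one_mul]

theorem conj_mul_conj_of_mem_USp4 {B : Matrix (Fin 4) (Fin 4) ℂ} (hB : B ∈ USp4)
    (D E : Matrix (Fin 4) (Fin 4) ℂ) : B * D * B⁻¹ * (B * E * B⁻¹) = B * (D * E) * B⁻¹ := by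
  rw [Matrix.mul_assoc B E, ← Matrix.mul_assoc (B * D * B⁻¹), Matrix.mul_assoc (B * D) B⁻¹ B,
    Matrix.nonsing_inv_mul _ (isUnit_det_of_mem_USp4 hB), mul_one]
  simp only [Matrix.mul_assoc]

theorem cosSum_conj {B : Matrix (Fin 4) (Fin 4) ℂ} (hB : B ∈ USp4)
    (D : Matrix (Fin 4) (Fin 4) ℂ) : cosSum (B * D * B⁻¹) = cosSum D := by
  rw [cosSum, cosSum, trace_conj_of_mem_USp4 hB]

theorem cosProd_conj {B : Matrix (Fin 4) (Fin 4) ℂ} (hB : B ∈ USp4)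
    (D : Matrix (Fin 4) (Fin 4) ℂ) : cosProd (B * D * B⁻¹) = cosProd D := by
  rw [cosProd, cosProd, cosSum_conj hB, conj_mul_conj_of_mem_USp4 hB, trace_conj_of_mem_USp4 hB]

/-- The traces of the powers of an element of `USp(4)` are polynomials in `cosSum` and
`cosProd`. -/
theorem trace_pow_of_mem_USp4 {A : Matrix (Fin 4) (Fin 4) ℂ} (hA : A ∈ USp4) :
    (A * A).trace = 4 * cosSum A ^ 2 - 8 * cosProd A - 4 ∧
    (A * (A * A)).trace = 8 * cosSum A ^ 3 - 24 * cosSum A * cosProd A - 6 * cosSum A ∧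
    (A * A * (A * A)).trace = 16 * cosSum A ^ 4 - 64 * cosSum A ^ 2 * cosProd A +
      32 * cosProd A ^ 2 - 16 * cosSum A ^ 2 + 32 * cosProd A + 4 := by
  obtain ⟨x, -, y, -, B, hB, rfl⟩ := exists_conj_uspDiag hA
  generalize Real.arccos x = a, Real.arccos y = b
  have h4 : ∀ a : ℝ, a + a + (a + a) = 2 * (2 * a) := fun a => by ring
  have h3 : ∀ a : ℝ, a + (a + a) = 3 * a := fun a => by ring
  simp only [conj_mul_conj_of_mem_USp4 hB, trace_conj_of_mem_USp4 hB, cosSum_conj hB,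
    cosProd_conj hB, uspDiag_mul_uspDiag, trace_uspDiag, cosSum_uspDiag, cosProd_uspDiag, h3, h4]
  simp only [← two_mul, Real.cos_two_mul, Real.cos_three_mul]
  push_cast
  refine ⟨?_, ?_, ?_⟩ <;> ring

theorem symplectic_adjoint_mul {A : Matrix (Fin 4) (Fin 4) ℂ} (hA : A ∈ USp4) :
    Jmat * A.transpose * Jmat * A = -1 := by
  rw [← neg_neg (Jmat * A.transpose * Jmat), ← star_eq_symplectic_adjoint hA, neg_mul,
    star_mul_self_of_mem_USp4 hA]

theorem sum_cosSumDeriv_sq {A : Matrix (Fin 4) (Fin 4) ℂ} (hA : A ∈ USp4) :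
    ∑ n, cosSumDeriv (spBasis n) A ^ 2 = 2 * (2 - cosSum A ^ 2 + 2 * cosProd A) := by
  have h := sum_trace_spBasis_mul A A
  rw [symplectic_adjoint_mul hA, (trace_pow_of_mem_USp4 hA).1, Matrix.trace_neg,
    Matrix.trace_one, Fintype.card_fin] at h
  simp only [← sq] at h
  simp only [cosSumDeriv, div_pow, ← Finset.sum_div]
  rw [h]
  push_cast
  ring

theorem sum_trace_mul_trace_sq {A : Matrix (Fin 4) (Fin 4) ℂ} (hA : A ∈ USp4) :
    ∑ n, cosSumDeriv (spBasis n) A * (spBasis n * (A * A)).trace =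
      -8 * cosSum A * (cosSum A ^ 2 - 3 * cosProd A - 1) := by
  have h := sum_trace_spBasis_mul A (A * A)
  rw [← Matrix.mul_assoc (Jmat * _ * Jmat), symplectic_adjoint_mul hA,
    (trace_pow_of_mem_USp4 hA).2.1, neg_one_mul A, Matrix.trace_neg] at h
  have ht : A.trace = 2 * cosSum A := by rw [cosSum]; ring
  simp only [cosSumDeriv, div_mul_eq_mul_div, ← Finset.sum_div]
  rw [h, ht]
  ring

theorem sum_trace_sq_mul_trace_sq {A : Matrix (Fin 4) (Fin 4) ℂ} (hA : A ∈ USp4) :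
    ∑ n, (spBasis n * (A * A)).trace ^ 2 =
      -32 * (cosSum A ^ 4 - 4 * cosSum A ^ 2 * cosProd A + 2 * cosProd A ^ 2 - cosSum A ^ 2 +
        2 * cosProd A) := by
  have h := sum_trace_spBasis_mul (A * A) (A * A)
  rw [symplectic_adjoint_mul (mul_mem_USp4 hA hA), (trace_pow_of_mem_USp4 hA).2.2,
    Matrix.trace_neg, Matrix.trace_one, Fintype.card_fin] at h
  simp only [sq (Matrix.trace _), h]
  push_cast
  ring

theorem sum_trace_spBasis_conj_mul {A : Matrix (Fin 4) (Fin 4) ℂ} (hA : A ∈ USp4) :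
    ∑ n, (spBasis n * A * spBasis n * A).trace = -8 * (cosSum A ^ 2 + 1) := by
  have ht : A.trace = 2 * cosSum A := by rw [cosSum]; ring
  rw [← Matrix.trace_sum, ← Finset.sum_mul, sum_spBasis_conj, smul_mul_assoc, sub_mul,
    symplectic_adjoint_mul hA, smul_mul_assoc, one_mul, Matrix.trace_smul, Matrix.trace_sub,
    Matrix.trace_neg, Matrix.trace_one, Fintype.card_fin, Matrix.trace_smul, ht]
  simp only [smul_eq_mul]
  push_cast
  ring

theorem sum_cosSumDeriv_mul_cosProdDeriv {A : Matrix (Fin 4) (Fin 4) ℂ} (hA : A ∈ USp4) :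
    ∑ n, cosSumDeriv (spBasis n) A * cosProdDeriv (spBasis n) A =
      2 * cosSum A * (1 - cosProd A) := by
  have he : ∀ n, cosSumDeriv (spBasis n) A * cosProdDeriv (spBasis n) A =
      cosSum A * cosSumDeriv (spBasis n) A ^ 2 -
        1 / 4 * (cosSumDeriv (spBasis n) A * (spBasis n * (A * A)).trace) := fun n => by
    rw [cosProdDeriv]; ring
  simp only [he, Finset.sum_sub_distrib, ← Finset.mul_sum, sum_cosSumDeriv_sq hA,
    sum_trace_mul_trace_sq hA]
  ring

theorem sum_cosProdDeriv_sq {A : Matrix (Fin 4) (Fin 4) ℂ} (hA : A ∈ USp4) :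
    ∑ n, cosProdDeriv (spBasis n) A ^ 2 =
      2 * (cosSum A ^ 2 - 2 * cosProd A - 2 * cosProd A ^ 2) := by
  have he : ∀ n, cosProdDeriv (spBasis n) A ^ 2 =
      cosSum A ^ 2 * cosSumDeriv (spBasis n) A ^ 2 -
        cosSum A / 2 * (cosSumDeriv (spBasis n) A * (spBasis n * (A * A)).trace) +
        1 / 16 * (spBasis n * (A * A)).trace ^ 2 := fun n => by
    rw [cosProdDeriv]; ring
  simp only [he, Finset.sum_sub_distrib, Finset.sum_add_distrib, ← Finset.mul_sum,
    sum_cosSumDeriv_sq hA, sum_trace_mul_trace_sq hA, sum_trace_sq_mul_trace_sq hA]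
  ring

theorem sum_cosProdDeriv2 {A : Matrix (Fin 4) (Fin 4) ℂ} (hA : A ∈ USp4) :
    ∑ n, cosProdDeriv2 (spBasis n) A = -4 * (1 + 4 * cosProd A) := by
  simp only [cosProdDeriv2, Finset.sum_add_distrib, Finset.sum_sub_distrib, ← Finset.sum_div,
    sum_cosSumDeriv_sq hA, sum_trace_spBasis_conj_mul hA, (trace_pow_of_mem_USp4 hA).1,
    Finset.sum_const, Finset.card_univ, Fintype.card_fin, nsmul_eq_mul]
  push_cast
  ring

theorem sum_monomialDeriv2_eq_radialLaplacian {A : Matrix (Fin 4) (Fin 4) ℂ} (hA : A ∈ USp4)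
    (i j : ℕ) :
    ∑ n, monomialDeriv2 i j (cosSum A) (cosProd A) (cosSumDeriv (spBasis n) A)
      (cosProdDeriv (spBasis n) A) (-cosSum A) (cosProdDeriv2 (spBasis n) A) =
      2 * radialLaplacian i j (cosSum A) (cosProd A) := by
  simp only [monomialDeriv2, Finset.sum_add_distrib, ← Finset.mul_sum, sum_cosSumDeriv_sq hA,
    sum_cosSumDeriv_mul_cosProdDeriv hA, sum_cosProdDeriv_sq hA, sum_cosProdDeriv2 hA,
    Finset.sum_const, Finset.card_univ, Fintype.card_fin, nsmul_eq_mul, radialLaplacian]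
  rcases i with _ | _ | i <;> rcases j with _ | _ | j <;>
    simp only [Nat.add_sub_cancel, Nat.cast_zero, Nat.cast_add, Nat.cast_one, Nat.cast_ofNat,
      pow_succ, pow_zero, add_assoc, Nat.reduceAdd, Nat.zero_sub, Nat.reduceSub, zero_add,
      Nat.add_succ_sub_one] <;>
    ring

theorem continuous_trace_mul (X : Matrix (Fin 4) (Fin 4) ℂ) :
    Continuous fun A : Matrix (Fin 4) (Fin 4) ℂ => (X * A).trace :=
  (continuous_const.matrix_mul continuous_id).matrix_trace

theorem continuous_cosSum : Continuous cosSum := by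
  unfold cosSum
  exact continuous_id.matrix_trace.div_const 2

theorem continuous_cosProd : Continuous cosProd := by
  have h := (continuous_id.matrix_mul continuous_id :
    Continuous fun A : Matrix (Fin 4) (Fin 4) ℂ => A * A).matrix_trace
  unfold cosProd
  exact (((continuous_cosSum.pow 2).div_const 2).sub (h.div_const 8)).sub continuous_const

theorem continuous_cosSumDeriv (X : Matrix (Fin 4) (Fin 4) ℂ) : Continuous (cosSumDeriv X) := by
  unfold cosSumDeriv
  exact (continuous_trace_mul X).div_const 2

theorem continuous_cosProdDeriv (X : Matrix (Fin 4) (Fin 4) ℂ) :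
    Continuous (cosProdDeriv X) := by
  unfold cosProdDeriv
  exact (continuous_cosSum.mul (continuous_cosSumDeriv X)).sub
    (((continuous_trace_mul X).comp (continuous_id.matrix_mul continuous_id)).div_const 4)

theorem continuous_cosProdDeriv2 (X : Matrix (Fin 4) (Fin 4) ℂ) :
    Continuous (cosProdDeriv2 X) := by
  unfold cosProdDeriv2
  have h1 := (continuous_id.matrix_mul continuous_id :
    Continuous fun A : Matrix (Fin 4) (Fin 4) ℂ => A * A).matrix_trace
  have h2 := (((continuous_const.matrix_mul continuous_id).matrix_mul
    continuous_const).matrix_mul continuous_id :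
    Continuous fun A : Matrix (Fin 4) (Fin 4) ℂ => X * A * X * A).matrix_trace
  exact (((continuous_cosSumDeriv X).pow 2).sub (continuous_cosSum.pow 2)).add
    ((h1.sub h2).div_const 4)

theorem integral_radialLaplacian_cosSum_cosProd [MeasurableSpace (Matrix (Fin 4) (Fin 4) ℂ)]
    [BorelSpace (Matrix (Fin 4) (Fin 4) ℂ)] {μ : Measure (Matrix (Fin 4) (Fin 4) ℂ)}
    [IsFiniteMeasure μ] (hcarrier : μ USp4ᶜ = 0)
    (hinv : ∀ B ∈ USp4, μ.map (fun A => B * A) = μ) (i j : ℕ) :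
    ∫ A, radialLaplacian i j (cosSum A) (cosProd A) ∂μ = 0 := by
  have hs := continuous_cosSum
  have hp := continuous_cosProd
  have ha := fun n => continuous_cosSumDeriv (spBasis n)
  have hb := fun n => continuous_cosProdDeriv (spBasis n)
  have hb' := fun n => continuous_cosProdDeriv2 (spBasis n)
  have hc : ∀ n, Continuous fun A => monomialDeriv2 i j (cosSum A) (cosProd A)
      (cosSumDeriv (spBasis n) A) (cosProdDeriv (spBasis n) A) (-cosSum A)
      (cosProdDeriv2 (spBasis n) A) := fun n => by
    have := ha n
    have := hb n
    have := hb' n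
    unfold monomialDeriv2
    fun_prop
  have h0 : ∀ n, ∫ A, monomialDeriv2 i j (cosSum A) (cosProd A) (cosSumDeriv (spBasis n) A)
      (cosProdDeriv (spBasis n) A) (-cosSum A) (cosProdDeriv2 (spBasis n) A) ∂μ = 0 := fun n => by
    refine integral_eq_zero_of_hasDerivAt_matRotation hcarrier hinv (n := n)
      (F := fun A => monomialDeriv i j (cosSum A) (cosProd A) (cosSumDeriv (spBasis n) A)
        (cosProdDeriv (spBasis n) A)) ?_ (hc n) fun A => ?_
    · have := ha n
      have := hb n
      unfold monomialDeriv
      fun_prop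
    · have h := HasDerivAt.monomialDeriv (t := 0)
        (a := fun t => cosSumDeriv (spBasis n) (matRotation (spBasis n) t * A))
        (b := fun t => cosProdDeriv (spBasis n) (matRotation (spBasis n) t * A))
        (by simpa only [matRotation_zero, one_mul] using hasDerivAt_cosSum_matRotation A)
        (by simpa only [matRotation_zero, one_mul] using hasDerivAt_cosProd_matRotation A)
        (hasDerivAt_cosSumDeriv_matRotation A (spBasis_mul_self n))
        (hasDerivAt_cosProdDeriv_matRotation A (spBasis_mul_self n)) i j
      simpa only [matRotation_zero, one_mul] using h
  have hsum := integral_finsetSum (μ := μ) Finset.univ fun n _ =>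
    integrable_of_continuous_of_isCompact isCompact_USp4 hcarrier (hc n)
  rw [Finset.sum_eq_zero fun n _ => h0 n] at hsum
  have he : ∫ A, 2 * radialLaplacian i j (cosSum A) (cosProd A) ∂μ = 0 := by
    rw [← hsum]
    refine integral_congr_ae ?_
    filter_upwards [compl_mem_ae_iff.2 hcarrier] with A hA
    exact (sum_monomialDeriv2_eq_radialLaplacian (not_not.1 hA) i j).symm
  rw [integral_const_mul] at he
  exact (mul_eq_zero.1 he).resolve_left two_ne_zero

/-! ### The Weyl integration formula -/

theorem momentRecurrence_weylMeasure : MomentRecurrence fun i j =>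
    ∫ z, ((Real.cos z.1 + Real.cos z.2 : ℝ) : ℂ) ^ i * ((Real.cos z.1 * Real.cos z.2 : ℝ) : ℂ) ^ j
      ∂weylMeasure := by
  refine momentRecurrence_of_integral_radialLaplacian (isCompact_Icc.prod isCompact_Icc)
    weylMeasure_compl (by fun_prop) (by fun_prop) fun i j => ?_
  have h := congrArg (Complex.ofReal) (integral_radialLaplacian_weylMeasure i j)
  rw [← integral_complex_ofReal, Complex.ofReal_zero] at h
  rw [← h]
  simp [radialLaplacian]

theorem weylMeasure_univ : weylMeasure Set.univ = 1 := by
  have h := integral_weylMeasure fun _ => (1 : ℝ)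
  simp only [smul_eq_mul, mul_one, integral_weylDensity, integral_const] at h
  have h' : weylMeasure.real Set.univ = 1 := by
    rw [h]
    have := Real.pi_ne_zero
    field_simp
  rwa [Measure.real, ENNReal.toReal_eq_one_iff] at h'

theorem re_cosSum_cosProd_of_mem_USp4 {A : Matrix (Fin 4) (Fin 4) ℂ} (hA : A ∈ USp4) :
    ((cosSum A).re : ℂ) = cosSum A ∧ ((cosProd A).re : ℂ) = cosProd A := by
  obtain ⟨x, -, y, -, B, hB, rfl⟩ := exists_conj_uspDiag hA
  rw [cosSum_conj hB, cosProd_conj hB, cosSum_uspDiag, cosProd_uspDiag]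
  exact ⟨by rw [Complex.ofReal_re], by rw [Complex.ofReal_re]⟩

/-- The joint distribution of `cosSum` and `cosProd` under the Haar measure of `USp(4)`. -/
theorem map_cosSum_cosProd [MeasurableSpace (Matrix (Fin 4) (Fin 4) ℂ)]
    [BorelSpace (Matrix (Fin 4) (Fin 4) ℂ)] {μ : Measure (Matrix (Fin 4) (Fin 4) ℂ)}
    [IsProbabilityMeasure μ] (hcarrier : μ USp4ᶜ = 0)
    (hinv : ∀ B ∈ USp4, μ.map (fun A => B * A) = μ) :
    μ.map (fun A => ((cosSum A).re, (cosProd A).re)) =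
      weylMeasure.map fun z => (Real.cos z.1 + Real.cos z.2, Real.cos z.1 * Real.cos z.2) := by
  have hc₁ : Continuous fun A => ((cosSum A).re, (cosProd A).re) :=
    (Complex.continuous_re.comp continuous_cosSum).prodMk
      (Complex.continuous_re.comp continuous_cosProd)
  have hc₂ : Continuous fun z : ℝ × ℝ =>
      (Real.cos z.1 + Real.cos z.2, Real.cos z.1 * Real.cos z.2) := by fun_prop
  have hK₁ := isCompact_USp4.image hc₁
  have hK₂ := (isCompact_Icc (a := (0 : ℝ)) (b := Real.pi)).prod
    (isCompact_Icc (a := (0 : ℝ)) (b := Real.pi)) |>.image hc₂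
  refine measure_ext_of_moments (hK₁.union hK₂) ?_ ?_ fun i j => ?_
  · rw [Measure.map_apply hc₁.measurable (hK₁.union hK₂).measurableSet.compl]
    exact measure_mono_null (fun A hA hA' => hA (Or.inl ⟨A, hA', rfl⟩)) hcarrier
  · rw [Measure.map_apply hc₂.measurable (hK₁.union hK₂).measurableSet.compl]
    exact measure_mono_null (fun z hz hz' => hz (Or.inr ⟨z, hz', rfl⟩)) weylMeasure_compl
  · have hm : Continuous fun z : ℝ × ℝ => z.1 ^ i * z.2 ^ j := by fun_prop
    rw [integral_map hc₁.measurable.aemeasurable hm.measurable.aestronglyMeasurable,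
      integral_map hc₂.measurable.aemeasurable hm.measurable.aestronglyMeasurable]
    have h := (momentRecurrence_of_integral_radialLaplacian isCompact_USp4 hcarrier
      continuous_cosSum continuous_cosProd
      (integral_radialLaplacian_cosSum_cosProd hcarrier hinv)).unique momentRecurrence_weylMeasure
      (by simp [Measure.real, weylMeasure_univ]) i j
    apply Complex.ofReal_injective
    rw [← integral_complex_ofReal, ← integral_complex_ofReal]
    refine Eq.trans (integral_congr_ae ?_) (h.trans ?_)
    · filter_upwards [compl_mem_ae_iff.2 hcarrier] with A hA
      have hre := re_cosSum_cosProd_of_mem_USp4 (not_not.1 hA)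
      rw [Complex.ofReal_mul, Complex.ofReal_pow, Complex.ofReal_pow, hre.1, hre.2]
    · simp

/-- The value of a class function on the elements of `USp(4)` with `cosSum = z.1` and
`cosProd = z.2`. -/
noncomputable def classFunctionOnInvariants (f : Matrix (Fin 4) (Fin 4) ℂ → ℂ) (z : ℝ × ℝ) : ℂ :=
  f (uspDiag (Real.arccos ((z.1 + √(z.1 ^ 2 - 4 * z.2)) / 2))
    (Real.arccos ((z.1 - √(z.1 ^ 2 - 4 * z.2)) / 2)))

theorem continuous_uspDiag : Continuous fun z : ℝ × ℝ => uspDiag z.1 z.2 := by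
  refine Continuous.matrix_diagonal (continuous_pi fun i => ?_)
  fin_cases i <;> simp <;> fun_prop

theorem continuous_classFunctionOnInvariants {f : Matrix (Fin 4) (Fin 4) ℂ → ℂ}
    (hf : Continuous f) : Continuous (classFunctionOnInvariants f) := by
  have h : Continuous fun z : ℝ × ℝ =>
      (Real.arccos ((z.1 + √(z.1 ^ 2 - 4 * z.2)) / 2),
        Real.arccos ((z.1 - √(z.1 ^ 2 - 4 * z.2)) / 2)) := by
    refine (Real.continuous_arccos.comp ?_).prodMk (Real.continuous_arccos.comp ?_) <;> fun_prop
  exact hf.comp (continuous_uspDiag.comp h)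

theorem classFunctionOnInvariants_cos {f : Matrix (Fin 4) (Fin 4) ℂ → ℂ}
    (hconj : ∀ A ∈ USp4, ∀ B ∈ USp4, f (B * A * B⁻¹) = f A) {a b : ℝ}
    (ha : a ∈ Set.Icc 0 Real.pi) (hb : b ∈ Set.Icc 0 Real.pi) :
    classFunctionOnInvariants f (Real.cos a + Real.cos b, Real.cos a * Real.cos b) =
      f (uspDiag a b) := by
  have e : (Real.cos a + Real.cos b) ^ 2 - 4 * (Real.cos a * Real.cos b) =
      (Real.cos a - Real.cos b) ^ 2 := by ring
  have e1 : ∀ x y : ℝ, (x + y + (x - y)) / 2 = x := fun x y => by ring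
  have e2 : ∀ x y : ℝ, (x + y - (x - y)) / 2 = y := fun x y => by ring
  have e3 : ∀ x y : ℝ, (x + y + -(x - y)) / 2 = y := fun x y => by ring
  have e4 : ∀ x y : ℝ, (x + y - -(x - y)) / 2 = x := fun x y => by ring
  rw [classFunctionOnInvariants]
  simp only [e, Real.sqrt_sq_eq_abs]
  rcases abs_cases (Real.cos a - Real.cos b) with h | h
  · rw [h.1, e1, e2, Real.arccos_cos ha.1 ha.2, Real.arccos_cos hb.1 hb.2]
  · rw [h.1, e3, e4, Real.arccos_cos ha.1 ha.2, Real.arccos_cos hb.1 hb.2,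
      ← planeSwap_conj_uspDiag a b, hconj _ (uspDiag_mem_USp4 a b) _ planeSwap_mem_USp4]

theorem classFunctionOnInvariants_of_mem_USp4 {f : Matrix (Fin 4) (Fin 4) ℂ → ℂ}
    (hconj : ∀ A ∈ USp4, ∀ B ∈ USp4, f (B * A * B⁻¹) = f A) {A : Matrix (Fin 4) (Fin 4) ℂ}
    (hA : A ∈ USp4) : classFunctionOnInvariants f ((cosSum A).re, (cosProd A).re) = f A := by
  obtain ⟨x, -, y, -, B, hB, rfl⟩ := exists_conj_uspDiag hA
  rw [cosSum_conj hB, cosProd_conj hB, cosSum_uspDiag, cosProd_uspDiag, Complex.ofReal_re,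
    Complex.ofReal_re, hconj _ (uspDiag_mem_USp4 _ _) _ hB]
  exact classFunctionOnInvariants_cos hconj ⟨Real.arccos_nonneg x, Real.arccos_le_pi x⟩
    ⟨Real.arccos_nonneg y, Real.arccos_le_pi y⟩

/-- **Weyl integration formula for `USp(4)`.**  If `μ` is the Haar probability measure of
`USp(4)` (formalized as a Borel probability measure on the space of `4 × 4` complex matrices,
carried by `USp(4)` and invariant under left translation by every element of `USp(4)`, which
characterizes it uniquely), then for every continuous function `f` that is invariant under
conjugation by elements of `USp(4)`,
`∫ f dμ = (8/π²) ∫₀^π ∫₀^π f(diag(e^{iθ₁}, e^{-iθ₁}, e^{iθ₂}, e^{-iθ₂}))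
  (cos θ₁ - cos θ₂)² sin² θ₁ sin² θ₂ dθ₁ dθ₂`. -/
theorem stmt_13 [MeasurableSpace (Matrix (Fin 4) (Fin 4) ℂ)]
    [BorelSpace (Matrix (Fin 4) (Fin 4) ℂ)]
    (μ : Measure (Matrix (Fin 4) (Fin 4) ℂ)) [IsProbabilityMeasure μ]
    (hcarrier : μ USp4ᶜ = 0)
    (hinv : ∀ B ∈ USp4, μ.map (fun A => B * A) = μ)
    (f : Matrix (Fin 4) (Fin 4) ℂ → ℂ) (hf : Continuous f)
    (hconj : ∀ A ∈ USp4, ∀ B ∈ USp4, f (B * A * B⁻¹) = f A) :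
    ∫ A, f A ∂μ =
      (8 / Real.pi ^ 2 : ℝ) •
        ∫ θ₁ in (0 : ℝ)..Real.pi, ∫ θ₂ in (0 : ℝ)..Real.pi,
          (((Real.cos θ₁ - Real.cos θ₂) ^ 2 * Real.sin θ₁ ^ 2 * Real.sin θ₂ ^ 2 : ℝ) •
            f (uspDiag θ₁ θ₂)) := by
  have hφ := continuous_classFunctionOnInvariants hf
  have hc₁ : Continuous fun A => ((cosSum A).re, (cosProd A).re) :=
    (Complex.continuous_re.comp continuous_cosSum).prodMk
      (Complex.continuous_re.comp continuous_cosProd)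
  have hc₂ : Continuous fun z : ℝ × ℝ =>
      (Real.cos z.1 + Real.cos z.2, Real.cos z.1 * Real.cos z.2) := by fun_prop
  have hg : Continuous fun z : ℝ × ℝ => weylDensity z.1 z.2 • f (uspDiag z.1 z.2) :=
    continuous_weylDensity.smul (hf.comp continuous_uspDiag)
  calc ∫ A, f A ∂μ
      = ∫ A, classFunctionOnInvariants f ((cosSum A).re, (cosProd A).re) ∂μ := by
        refine integral_congr_ae ?_
        filter_upwards [compl_mem_ae_iff.2 hcarrier] with A hA
        exact (classFunctionOnInvariants_of_mem_USp4 hconj (not_not.1 hA)).symm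
    _ = ∫ z, classFunctionOnInvariants f z
          ∂weylMeasure.map fun z =>
            (Real.cos z.1 + Real.cos z.2, Real.cos z.1 * Real.cos z.2) := by
        rw [← map_cosSum_cosProd hcarrier hinv,
          integral_map hc₁.measurable.aemeasurable hφ.measurable.aestronglyMeasurable]
    _ = ∫ z, f (uspDiag z.1 z.2) ∂weylMeasure := by
        rw [integral_map hc₂.measurable.aemeasurable hφ.measurable.aestronglyMeasurable]
        refine integral_congr_ae ?_
        filter_upwards [compl_mem_ae_iff.2 weylMeasure_compl] with z hz
        exact classFunctionOnInvariants_cos hconj (not_not.1 hz).1 (not_not.1 hz).2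
    _ = _ := by
        rw [integral_weylMeasure, integral_angleMeasure hg]
        rfl
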